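/- arXiv:1904.12782 — 4 statements merged into one kernel-verified Lean document; each statement's English description precedes it below -/
import Mathlib

section
/- Let E₀ and E₁ be finite-dimensional real inner product spaces, let R : E₀ → E₁ be a linear map with adjoint R* : E₁ → E₀, and let V₀ ∈ End(E₀) and V₁ ∈ End(E₁) be skew-adjoint endomorphisms satisfying the intertwining relation V₁ ∘ R = R ∘ V₀. Then ker R is invariant under V₀, the orthogonal complement (range R)^⊥ is invariant under V₁, and det(−V₀² + R*R) · det((−V₁²) restricted to (range R)^⊥) = det(−V₁² + R R*) · det((−V₀²) restricted to ker R). -/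
/-- If `R` intertwines `A` and `B`, then `det A` and `det B` agree up to the contributions
of the kernel and the cokernel of `R`, the cokernel being realised on a complement `C`. -/
theorem LinearMap.det_mul_det_restrict_of_intertwines {K E F : Type*} [Field K]
    [AddCommGroup E] [Module K E] [FiniteDimensional K E]
    [AddCommGroup F] [Module K F] [FiniteDimensional K F]
    {R : E →ₗ[K] F} {A : E →ₗ[K] E} {B : F →ₗ[K] F} (h : B ∘ₗ R = R ∘ₗ A)
    {C : Submodule K F} (hC : IsCompl (range R) C)
    (hA : ∀ x ∈ ker R, A x ∈ ker R) (hB : ∀ y ∈ C, B y ∈ C) :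
    LinearMap.det A * LinearMap.det (B.restrict hB) =
      LinearMap.det B * LinearMap.det (A.restrict hA) := by
  have hrange : ∀ y ∈ range R, B y ∈ range R := by
    rintro _ ⟨x, rfl⟩
    exact ⟨A x, (LinearMap.congr_fun h x).symm⟩
  have hquotA : LinearMap.det ((ker R).mapQ (ker R) A hA) =
      LinearMap.det (B.restrict hrange) := by
    rw [← LinearMap.det_conj _ R.quotKerEquivRange]
    congr 1
    ext ⟨_, x, rfl⟩
    have hx : R.quotKerEquivRange.symm ⟨R x, x, rfl⟩ = (ker R).mkQ x :=
      R.quotKerEquivRange_symm_apply_image x _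
    simpa [hx] using (LinearMap.congr_fun h x).symm
  have hquotB : LinearMap.det ((range R).mapQ (range R) B hrange) =
      LinearMap.det (B.restrict hB) := by
    rw [← LinearMap.det_conj (B.restrict hB) (Submodule.quotientEquivOfIsCompl _ _ hC).symm]
    congr 1
    ext y
    obtain ⟨z, hz⟩ := (Submodule.quotientEquivOfIsCompl _ _ hC).symm.surjective
      ((range R).mkQ y)
    simp only [Submodule.quotientEquivOfIsCompl_symm_apply] at hz
    simp only [LinearMap.comp_apply, ← hz]
    simp
  rw [A.det_eq_det_mul_det (ker R) hA, B.det_eq_det_mul_det (range R) hrange, hquotA, hquotB]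
  ring

/-- For finite-dimensional real inner product spaces `E₀`, `E₁`, a linear map
`R : E₀ → E₁` and skew-adjoint `V₀`, `V₁` with `V₁ ∘ R = R ∘ V₀`:
`ker R` is `V₀`-invariant, `(range R)ᗮ` is `V₁`-invariant, and
`det(−V₀² + R*R) · det((−V₁²)|_{(range R)ᗮ}) = det(−V₁² + RR*) · det((−V₀²)|_{ker R})`. -/
theorem stmt1 (E₀ E₁ : Type*)
    [NormedAddCommGroup E₀] [InnerProductSpace ℝ E₀] [FiniteDimensional ℝ E₀]
    [NormedAddCommGroup E₁] [InnerProductSpace ℝ E₁] [FiniteDimensional ℝ E₁]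
    (R : E₀ →ₗ[ℝ] E₁) (V₀ : E₀ →ₗ[ℝ] E₀) (V₁ : E₁ →ₗ[ℝ] E₁)
    (hV₀ : LinearMap.adjoint V₀ = -V₀) (hV₁ : LinearMap.adjoint V₁ = -V₁)
    (hRV : V₁ ∘ₗ R = R ∘ₗ V₀) :
    (∀ x ∈ LinearMap.ker R, V₀ x ∈ LinearMap.ker R) ∧
    (∀ y ∈ (LinearMap.range R)ᗮ, V₁ y ∈ (LinearMap.range R)ᗮ) ∧
    ∃ (h₀ : ∀ x ∈ LinearMap.ker R, (-(V₀ ∘ₗ V₀)) x ∈ LinearMap.ker R)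
      (h₁ : ∀ y ∈ (LinearMap.range R)ᗮ, (-(V₁ ∘ₗ V₁)) y ∈ (LinearMap.range R)ᗮ),
      LinearMap.det (-(V₀ ∘ₗ V₀) + (LinearMap.adjoint R) ∘ₗ R) *
        LinearMap.det ((-(V₁ ∘ₗ V₁)).restrict h₁)
      = LinearMap.det (-(V₁ ∘ₗ V₁) + R ∘ₗ (LinearMap.adjoint R)) *
        LinearMap.det ((-(V₀ ∘ₗ V₀)).restrict h₀) := by
  have hker : ∀ x ∈ LinearMap.ker R, V₀ x ∈ LinearMap.ker R := fun x hx => by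
    rw [LinearMap.mem_ker] at hx ⊢
    rw [← LinearMap.comp_apply, ← hRV, LinearMap.comp_apply, hx, map_zero]
  have hperp : ∀ y ∈ (LinearMap.range R)ᗮ, V₁ y ∈ (LinearMap.range R)ᗮ := by
    rintro y hy _ ⟨x, rfl⟩
    rw [← LinearMap.adjoint_inner_left, hV₁, LinearMap.neg_apply, inner_neg_left,
      ← LinearMap.comp_apply, hRV, LinearMap.comp_apply, hy _ ⟨V₀ x, rfl⟩, neg_zero]
  have hadj : ∀ y ∈ (LinearMap.range R)ᗮ, LinearMap.adjoint R y = 0 := fun y hy => by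
    rwa [LinearMap.orthogonal_range] at hy
  have h₀ : ∀ x ∈ LinearMap.ker R, (-(V₀ ∘ₗ V₀)) x ∈ LinearMap.ker R := fun x hx =>
    neg_mem (hker _ (hker x hx))
  have h₁ : ∀ y ∈ (LinearMap.range R)ᗮ, (-(V₁ ∘ₗ V₁)) y ∈ (LinearMap.range R)ᗮ :=
    fun y hy => neg_mem (hperp _ (hperp y hy))
  refine ⟨hker, hperp, h₀, h₁, ?_⟩
  have hA : ∀ x ∈ LinearMap.ker R,
      (-(V₀ ∘ₗ V₀) + LinearMap.adjoint R ∘ₗ R) x = (-(V₀ ∘ₗ V₀)) x := fun x hx => by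
    simp [LinearMap.mem_ker.mp hx]
  have hB : ∀ y ∈ (LinearMap.range R)ᗮ,
      (-(V₁ ∘ₗ V₁) + R ∘ₗ LinearMap.adjoint R) y = (-(V₁ ∘ₗ V₁)) y := fun y hy => by
    simp [hadj y hy]
  have hV (x : E₀) : V₁ (R x) = R (V₀ x) := LinearMap.congr_fun hRV x
  have hint : (-(V₁ ∘ₗ V₁) + R ∘ₗ LinearMap.adjoint R) ∘ₗ R =
      R ∘ₗ (-(V₀ ∘ₗ V₀) + LinearMap.adjoint R ∘ₗ R) := by
    ext x
    simp [hV]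
  convert LinearMap.det_mul_det_restrict_of_intertwines hint
    (LinearMap.range R).isCompl_orthogonal
    (fun x hx => (hA x hx).symm ▸ h₀ x hx) (fun y hy => (hB y hy).symm ▸ h₁ y hy) using 3
  · ext y
    exact (hB y y.2).symm
  · ext x
    exact (hA x x.2).symm
end

section
/- Let E₀ and E₁ be finite-dimensional real inner product spaces, let R : E₀ → E₁ be a linear map, and let V₀ ∈ End(E₀) and V₁ ∈ End(E₁) be skew-adjoint endomorphisms satisfying V₁ ∘ R = R ∘ V₀. Then: (1) R restricts to a linear isomorphism from (ker R)^⊥ onto range R; (2) −V₀² preserves (ker R)^⊥ and −V₁² preserves range R, and R intertwines these restrictions, i.e. R ∘ (−V₀²) = (−V₁²) ∘ R; consequently (3) det((−V₀²) restricted to (ker R)^⊥) = det((−V₁²) restricted to range R). -/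
/-- The orthogonal complement of a subspace invariant under `adjoint T` is invariant under `T`. -/
theorem LinearMap.apply_mem_orthogonal_of_adjoint_mem {E : Type*} [NormedAddCommGroup E]
    [InnerProductSpace ℝ E] [FiniteDimensional ℝ E] {T : E →ₗ[ℝ] E} {K : Submodule ℝ E}
    (hK : ∀ z ∈ K, LinearMap.adjoint T z ∈ K) {x : E} (hx : x ∈ Kᗮ) : T x ∈ Kᗮ := by
  rw [Submodule.mem_orthogonal] at hx ⊢
  intro z hz
  rw [← LinearMap.adjoint_inner_left]
  exact hx _ (hK z hz)

/-- With `R : E₀ → E₁` linear and `V₀`, `V₁` skew-adjoint satisfying `V₁ ∘ R = R ∘ V₀`: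
(1) `R` restricts to a linear isomorphism `(ker R)ᗮ ≃ range R`;
(2) `−V₀²` preserves `(ker R)ᗮ`, `−V₁²` preserves `range R`, and
`R ∘ (−V₀²) = (−V₁²) ∘ R`; consequently
(3) `det((−V₀²)|_{(ker R)ᗮ}) = det((−V₁²)|_{range R})`. -/
theorem stmt3 (E₀ E₁ : Type*)
    [NormedAddCommGroup E₀] [InnerProductSpace ℝ E₀] [FiniteDimensional ℝ E₀]
    [NormedAddCommGroup E₁] [InnerProductSpace ℝ E₁] [FiniteDimensional ℝ E₁]
    (R : E₀ →ₗ[ℝ] E₁) (V₀ : E₀ →ₗ[ℝ] E₀) (V₁ : E₁ →ₗ[ℝ] E₁)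
    (hV₀ : LinearMap.adjoint V₀ = -V₀) (hV₁ : LinearMap.adjoint V₁ = -V₁)
    (hRV : V₁ ∘ₗ R = R ∘ₗ V₀) :
    (∃ e : ↥((LinearMap.ker R)ᗮ) ≃ₗ[ℝ] ↥(LinearMap.range R),
        ∀ x : ↥((LinearMap.ker R)ᗮ), (e x : E₁) = R (x : E₀)) ∧
    R ∘ₗ (-(V₀ ∘ₗ V₀)) = (-(V₁ ∘ₗ V₁)) ∘ₗ R ∧
    ∃ (h₀ : ∀ x ∈ (LinearMap.ker R)ᗮ, (-(V₀ ∘ₗ V₀)) x ∈ (LinearMap.ker R)ᗮ)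
      (h₁ : ∀ y ∈ LinearMap.range R, (-(V₁ ∘ₗ V₁)) y ∈ LinearMap.range R),
      LinearMap.det ((-(V₀ ∘ₗ V₀)).restrict h₀)
        = LinearMap.det ((-(V₁ ∘ₗ V₁)).restrict h₁) := by
  have hR : ∀ x, V₁ (R x) = R (V₀ x) := LinearMap.congr_fun hRV
  have hcomm : R ∘ₗ (-(V₀ ∘ₗ V₀)) = (-(V₁ ∘ₗ V₁)) ∘ₗ R := by
    ext x
    simp [hR]
  have hadj : LinearMap.adjoint (-(V₀ ∘ₗ V₀)) = -(V₀ ∘ₗ V₀) := by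
    rw [map_neg, LinearMap.adjoint_comp, hV₀, LinearMap.neg_comp, LinearMap.comp_neg, neg_neg]
  have h₀ : ∀ x ∈ (LinearMap.ker R)ᗮ, (-(V₀ ∘ₗ V₀)) x ∈ (LinearMap.ker R)ᗮ := fun x hx =>
    LinearMap.apply_mem_orthogonal_of_adjoint_mem (fun z hz => by
      rw [hadj, LinearMap.mem_ker, ← LinearMap.comp_apply, hcomm, LinearMap.comp_apply,
        LinearMap.mem_ker.mp hz, map_zero]) hx
  have h₁ : ∀ y ∈ LinearMap.range R, (-(V₁ ∘ₗ V₁)) y ∈ LinearMap.range R := by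
    rintro _ ⟨x, rfl⟩
    exact ⟨_, LinearMap.congr_fun hcomm x⟩
  let e := R.kerComplementEquivRange (Submodule.isCompl_orthogonal (LinearMap.ker R)).symm
  have he : ∀ x, (e x : E₁) = R x := fun _ => rfl
  refine ⟨⟨e, he⟩, hcomm, h₀, h₁, ?_⟩
  rw [← LinearMap.det_conj _ e]
  congr 1
  ext y
  obtain ⟨x, rfl⟩ := e.surjective y
  simp only [LinearMap.comp_apply, LinearEquiv.coe_coe, LinearEquiv.symm_apply_apply, he,
    LinearMap.coe_restrict_apply]
  exact LinearMap.congr_fun hcomm x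
end

section
/- Let μ ∈ ℂ and let χ : ℂ → ℂ be differentiable at every point as a map of real vector spaces, with real Fréchet derivative Dχ(z) : ℂ → ℂ (an ℝ-linear map). Then χ satisfies Dχ(z)(1) − i·Dχ(z)(i) = 2 i μ conj(z) χ(z) for all z ∈ ℂ if and only if the function z ↦ χ(conj(z))·exp(−i μ z · conj(z)) is complex differentiable at every point of ℂ. In particular, the solutions are exactly the antiholomorphic functions multiplied by exp(i μ |z|²), i.e. χ(z) = h(conj z)·exp(i μ |z|²) with h entire. -/
open Complex in
theorem hasFDerivAt_comp_conj_mul_exp (μ : ℂ) {χ : ℂ → ℂ} (hχ : Differentiable ℝ χ) (w : ℂ) :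
    ∃ L : ℂ →L[ℝ] ℂ,
      HasFDerivAt (fun z : ℂ => χ ((starRingEnd ℂ) z) *
        exp (-(I * μ * (z * (starRingEnd ℂ) z)))) L w ∧
      ∀ v, L v = (fderiv ℝ χ ((starRingEnd ℂ) w) ((starRingEnd ℂ) v) -
        χ ((starRingEnd ℂ) w) * (I * μ * (w * (starRingEnd ℂ) v + (starRingEnd ℂ) w * v))) *
          exp (-(I * μ * (w * (starRingEnd ℂ) w))) := by
  have hconj : HasFDerivAt (fun z : ℂ => (starRingEnd ℂ) z) (conjCLE : ℂ →L[ℝ] ℂ) w :=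
    conjCLE.hasFDerivAt
  have hcomp := (hχ ((starRingEnd ℂ) w)).hasFDerivAt.comp w hconj
  have hexp := (((hasFDerivAt_id (𝕜 := ℝ) w).mul hconj).const_mul (I * μ)).neg.cexp
  refine ⟨_, hcomp.mul hexp, fun v => ?_⟩
  simp
  ring

/-- A real-differentiable `χ : ℂ → ℂ` satisfies
`Dχ(z)(1) − i·Dχ(z)(i) = 2 i μ z̄ χ(z)` everywhere if and only if
`z ↦ χ(z̄)·exp(−i μ z z̄)` is complex differentiable everywhere. -/
theorem stmt7 (μ : ℂ) (χ : ℂ → ℂ) (hχ : Differentiable ℝ χ) :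
    (∀ z : ℂ, fderiv ℝ χ z 1 - Complex.I * fderiv ℝ χ z Complex.I
        = 2 * Complex.I * μ * (starRingEnd ℂ) z * χ z)
    ↔ Differentiable ℂ
        (fun z : ℂ => χ ((starRingEnd ℂ) z) *
          Complex.exp (-(Complex.I * μ * (z * (starRingEnd ℂ) z)))) := by
  have hconj : Function.Involutive (starRingEnd ℂ) := Complex.conj_conj
  rw [hconj.surjective.forall]
  refine forall_congr' fun w => ?_
  obtain ⟨L, hL, hLv⟩ := hasFDerivAt_comp_conj_mul_exp μ hχ w
  rw [differentiableAt_complex_iff_differentiableAt_real, and_iff_right hL.differentiableAt,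
    hL.fderiv, hLv, hLv, smul_eq_mul, ← mul_assoc Complex.I (_ - _),
    mul_left_inj' (Complex.exp_ne_zero _)]
  simp only [Complex.conj_conj, Complex.conj_I, map_one, map_neg]
  constructor <;> intro h
  · linear_combination (-Complex.I) * h - fderiv ℝ χ ((starRingEnd ℂ) w) Complex.I * Complex.I_sq
  · linear_combination Complex.I * h + (fderiv ℝ χ ((starRingEnd ℂ) w) 1 -
      2 * Complex.I * χ ((starRingEnd ℂ) w) * μ * w) * Complex.I_sq
end

section
/- Let N ≥ 3 and let p₀, …, p_{N−1} ∈ ℝ² be the vertices, listed in cyclic order along the boundary (indices taken mod N), of a convex polygon P = conv{p₀, …, p_{N−1}} such that each p_i is an extreme point of P. Let ξ ∈ ℝ² satisfy ⟨ξ, p_{i+1} − p_i⟩ ≠ 0 for every i. For each vertex p_i let d_i⁻ = p_{i−1} − p_i and d_i⁺ = p_{i+1} − p_i be the two edge directions at p_i; call such a direction d 'flipped' if ⟨ξ, d⟩ > 0, and let f_i ∈ {0,1,2} be the number of flipped directions at p_i. Define the half-open polarized cone C_i ⊂ ℝ² as the set of points p_i + a e⁻ + b e⁺ where, for each sign ±: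 if d_i^± is not flipped then e^± = d_i^± and the corresponding coefficient ranges over [0, ∞), while if d_i^± is flipped then e^± = −d_i^± and the corresponding coefficient ranges over (0, ∞). Then for every x ∈ ℝ²: Σ_{i=0}^{N−1} (−1)^{f_i} · 𝟙_{C_i}(x) = 𝟙_P(x), i.e. the signed indicator functions of the polarized corner cones sum to the indicator function of the polygon. -/
open scoped RealInnerProductSpace

/-- The standard area form on the plane. -/
def planarCross (v w : EuclideanSpace ℝ (Fin 2)) : ℝ := v 0 * w 1 - v 1 * w 0

/-- The affine function vanishing on the line through `p i` and `p (i + 1)`, scaled by `σ`. -/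
def edgeHeight {N : ℕ} (σ : ℝ) (p : ZMod N → EuclideanSpace ℝ (Fin 2)) (i : ZMod N)
    (y : EuclideanSpace ℝ (Fin 2)) : ℝ :=
  σ * planarCross (p (i + 1) - p i) (y - p i)

/-- All vertices off an edge lie strictly on the positive side of that edge. -/
def IsStrictlyConvex {N : ℕ} (σ : ℝ) (p : ZMod N → EuclideanSpace ℝ (Fin 2)) : Prop :=
  ∀ i j : ZMod N, j ≠ i → j ≠ i + 1 → 0 < edgeHeight σ p i (p j)

section Cyclic

variable {N : ℕ}

lemma ZMod.one_ne_zero_of_three_le (hN : 3 ≤ N) : (1 : ZMod N) ≠ 0 := by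
  intro h
  have h' : ((1 : ℕ) : ZMod N) = 0 := by exact_mod_cast h
  rw [ZMod.natCast_eq_zero_iff] at h'
  have := Nat.le_of_dvd one_pos h'
  omega

lemma ZMod.two_ne_zero_of_three_le (hN : 3 ≤ N) : (2 : ZMod N) ≠ 0 := by
  intro h
  have h' : ((2 : ℕ) : ZMod N) = 0 := by exact_mod_cast h
  rw [ZMod.natCast_eq_zero_iff] at h'
  have := Nat.le_of_dvd two_pos h'
  omega

lemma ZMod.forall_of_add_one [NeZero N] {P : ZMod N → Prop} {i₀ : ZMod N} (h₀ : P i₀)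
    (hstep : ∀ i, P i → P (i + 1)) (i : ZMod N) : P i := by
  have hk : ∀ k : ℕ, P (i₀ + k) := by
    intro k
    induction k with
    | zero => simpa using h₀
    | succ k ih => simpa [add_assoc] using hstep _ ih
  have := hk (i - i₀).val
  rwa [ZMod.natCast_zmod_val, add_sub_cancel] at this

lemma sum_ite_eq_one_of_existsUnique {ι : Type*} [Fintype ι] {Q : ι → Prop} [DecidablePred Q]
    (h : ∃! i, Q i) : ∑ i, (if Q i then (1 : ℝ) else 0) = 1 := by
  obtain ⟨i, hi, huniq⟩ := h
  rw [Finset.sum_eq_single i, if_pos hi]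
  · intro j _ hj
    exact if_neg fun hQ => hj (huniq j hQ)
  · simp

/-- Expansion of the signed corner contributions into descents of `ε` minus ascents of `B`. -/
lemma sum_corner_eq [NeZero N] (ε B : ZMod N → ℝ) :
    ∑ i, (ε (i - 1) - B i) * (1 - B (i - 1) - ε i) =
      ∑ i, ε (i - 1) * (1 - ε i) - ∑ i, B i * (1 - B (i - 1)) := by
  have h : ∑ i, ε (i - 1) * B (i - 1) = ∑ i, ε i * B i :=
    (Equiv.subRight (1 : ZMod N)).sum_comp fun i => ε i * B i
  have h' : ∑ i, (ε (i - 1) - B i) * (1 - B (i - 1) - ε i) =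
      ∑ i, ε (i - 1) * (1 - ε i) - ∑ i, B i * (1 - B (i - 1))
        - ∑ i, ε (i - 1) * B (i - 1) + ∑ i, ε i * B i := by
    simp only [← Finset.sum_sub_distrib, ← Finset.sum_add_distrib]
    exact Finset.sum_congr rfl fun i _ => by ring
  rw [h', h]
  ring

end Cyclic

section Cone

/-- Membership in a half-open polarized cone in terms of the area form. -/
lemma mem_polarizedCone_iff {σ : ℝ} {q v w y : EuclideanSpace ℝ (Fin 2)} (F G : Prop)
    [Decidable F] [Decidable G] (hD : 0 < σ * planarCross w v) :
    (∃ a b : ℝ, (if F then 0 < a else 0 ≤ a) ∧ (if G then 0 < b else 0 ≤ b) ∧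
      y = q + a • (if F then -v else v) + b • (if G then -w else w)) ↔
    ((F ↔ σ * planarCross w (y - q) < 0) ∧ (G ↔ σ * planarCross (y - q) v < 0)) := by
  have hcoord : ∀ a b : ℝ, y = q + a • v + b • w →
      σ * planarCross w (y - q) = a * (σ * planarCross w v) ∧
      σ * planarCross (y - q) v = b * (σ * planarCross w v) := by
    rintro a b rfl
    constructor <;> simp [planarCross] <;> ring
  obtain ⟨a₀, b₀, h₀⟩ : ∃ a b : ℝ, y = q + a • v + b • w := by
    have hD' : planarCross w v ≠ 0 := right_ne_zero_of_mul hD.ne'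
    refine ⟨planarCross w (y - q) / planarCross w v, planarCross (y - q) v / planarCross w v, ?_⟩
    ext k
    fin_cases k <;> simp <;> field_simp <;> simp [planarCross] <;> ring
  have hneg : ∀ c : ℝ, c * (σ * planarCross w v) < 0 ↔ c < 0 := fun c => by
    simpa using mul_lt_mul_iff_left₀ (b := c) (c := 0) hD
  have huniq : ∀ a b : ℝ, y = q + a • v + b • w → a = a₀ ∧ b = b₀ := by
    intro a b h
    obtain ⟨h1, h2⟩ := hcoord a b h
    obtain ⟨h3, h4⟩ := hcoord a₀ b₀ h₀
    exact ⟨mul_right_cancel₀ hD.ne' (h1.symm.trans h3), mul_right_cancel₀ hD.ne' (h2.symm.trans h4)⟩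
  rw [(hcoord _ _ h₀).1, (hcoord _ _ h₀).2, hneg, hneg]
  constructor
  · rintro ⟨a, b, ha, hb, hy⟩
    have hy' : y = q + (if F then -a else a) • v + (if G then -b else b) • w := by
      rw [hy]; split_ifs <;> simp
    obtain ⟨h1, h2⟩ := huniq _ _ hy'
    rw [← h1, ← h2]
    constructor
    · by_cases hF : F <;> simpa [hF] using ha
    · by_cases hG : G <;> simpa [hG] using hb
  · rintro ⟨hF, hG⟩
    refine ⟨if F then -a₀ else a₀, if G then -b₀ else b₀, ?_, ?_, ?_⟩
    · split_ifs with h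
      · linarith [hF.1 h]
      · exact not_lt.1 (mt hF.2 h)
    · split_ifs with h
      · linarith [hG.1 h]
      · exact not_lt.1 (mt hG.2 h)
    · refine h₀.trans ?_
      split_ifs <;> simp

end Cone

section Polygon

variable {N : ℕ} {σ : ℝ} {p : ZMod N → EuclideanSpace ℝ (Fin 2)}

lemma edgeHeight_sub_one (i : ZMod N) (y : EuclideanSpace ℝ (Fin 2)) :
    edgeHeight σ p (i - 1) y = σ * planarCross (y - p i) (p (i - 1) - p i) := by
  simp only [edgeHeight, planarCross, sub_add_cancel, PiLp.sub_apply]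
  ring

/-- Coordinates of a point with respect to the two edge directions at the vertex `p i`. -/
lemma edgeHeight_smul_sub (i : ZMod N) (y : EuclideanSpace ℝ (Fin 2)) :
    edgeHeight σ p i (p (i - 1)) • (y - p i) =
      edgeHeight σ p i y • (p (i - 1) - p i) + edgeHeight σ p (i - 1) y • (p (i + 1) - p i) := by
  rw [edgeHeight_sub_one]
  ext k
  fin_cases k <;> simp [edgeHeight, planarCross] <;> ring

lemma edgeHeight_mul_map_sub (ℓ : EuclideanSpace ℝ (Fin 2) →ₗ[ℝ] ℝ) (i : ZMod N)
    (y : EuclideanSpace ℝ (Fin 2)) :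
    edgeHeight σ p i (p (i - 1)) * (ℓ y - ℓ (p i)) =
      edgeHeight σ p i y * (ℓ (p (i - 1)) - ℓ (p i)) +
        edgeHeight σ p (i - 1) y * (ℓ (p (i + 1)) - ℓ (p i)) := by
  simpa using congrArg ℓ (edgeHeight_smul_sub (σ := σ) (p := p) i y)

namespace IsStrictlyConvex

lemma edgeHeight_nonneg (hp : IsStrictlyConvex σ p) (i j : ZMod N) :
    0 ≤ edgeHeight σ p i (p j) := by
  by_cases h : j = i
  · simp [h, edgeHeight, planarCross]
  by_cases h' : j = i + 1
  · simp [h', edgeHeight, planarCross, mul_comm]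
  exact (hp i j h h').le

lemma edgeHeight_prev_pos (hN : 3 ≤ N) (hp : IsStrictlyConvex σ p) (i : ZMod N) :
    0 < edgeHeight σ p i (p (i - 1)) := by
  refine hp i _ (fun h => ZMod.one_ne_zero_of_three_le hN ?_)
    (fun h => ZMod.two_ne_zero_of_three_le hN ?_)
  · linear_combination -h
  · linear_combination -h

lemma edgeHeight_nonneg_of_mem_convexHull (hp : IsStrictlyConvex σ p)
    {x : EuclideanSpace ℝ (Fin 2)} (hx : x ∈ convexHull ℝ (Set.range p)) (i : ZMod N) :
    0 ≤ edgeHeight σ p i x := by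
  have hconv : Convex ℝ {y | 0 ≤ edgeHeight σ p i y} := by
    intro y hy z hz a b ha hb hab
    have hcomb : edgeHeight σ p i (a • y + b • z) =
        a * edgeHeight σ p i y + b * edgeHeight σ p i z := by
      obtain rfl : b = 1 - a := by linarith
      simp [edgeHeight, planarCross]
      ring
    simp only [Set.mem_ofPred_eq] at hy hz ⊢
    rw [hcomb]
    positivity
  have hsub : Set.range p ⊆ {y | 0 ≤ edgeHeight σ p i y} :=
    Set.range_subset_iff.2 fun j => hp.edgeHeight_nonneg i j
  exact convexHull_min hsub hconv hx

/-- A point on the nonnegative side of all edges belongs to the polygon. -/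
lemma mem_convexHull_of_edgeHeight_nonneg [NeZero N] (hN : 3 ≤ N) (hp : IsStrictlyConvex σ p)
    {x : EuclideanSpace ℝ (Fin 2)} (hx : ∀ i, 0 ≤ edgeHeight σ p i x) :
    x ∈ convexHull ℝ (Set.range p) := by
  by_contra hmem
  obtain ⟨f, u, hf, hu⟩ := geometric_hahn_banach_closed_point (convex_convexHull ℝ _)
    ((Set.finite_range p).isClosed_convexHull ℝ) hmem
  obtain ⟨i, hi⟩ := Finite.exists_max fun i => f (p i)
  have hcoord := edgeHeight_mul_map_sub (σ := σ) (p := p) f.toLinearMap i x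
  simp only [ContinuousLinearMap.coe_coe] at hcoord
  have hpi := hf (p i) (subset_convexHull ℝ _ (Set.mem_range_self i))
  have h1 := mul_nonneg (hx i) (sub_nonneg.2 (hi (i - 1)))
  have h2 := mul_nonneg (hx (i - 1)) (sub_nonneg.2 (hi (i + 1)))
  have h3 := mul_pos (hp.edgeHeight_prev_pos hN i) (sub_pos.2 (hpi.trans hu))
  linarith

/-- No point lies strictly on the negative side of all edges. -/
lemma exists_edgeHeight_nonneg [NeZero N] (hN : 3 ≤ N) (hp : IsStrictlyConvex σ p)
    {ℓ : EuclideanSpace ℝ (Fin 2) →ₗ[ℝ] ℝ} {i₀ : ZMod N} (hℓ : ℓ (p (i₀ + 1)) ≠ ℓ (p i₀))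
    (x : EuclideanSpace ℝ (Fin 2)) : ∃ i, 0 ≤ edgeHeight σ p i x := by
  by_contra! hx
  obtain ⟨i, hi⟩ := Finite.exists_max fun i => ℓ (p i)
  obtain ⟨j, hj⟩ := Finite.exists_min fun i => ℓ (p i)
  have hxi : ℓ (p i) ≤ ℓ x := by
    have h1 := mul_nonneg_of_nonpos_of_nonpos (hx i).le (sub_nonpos.2 (hi (i - 1)))
    have h2 := mul_nonneg_of_nonpos_of_nonpos (hx (i - 1)).le (sub_nonpos.2 (hi (i + 1)))
    rw [← sub_nonneg, ← mul_nonneg_iff_of_pos_left (hp.edgeHeight_prev_pos hN i),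
      edgeHeight_mul_map_sub]
    exact add_nonneg h1 h2
  have hxj : ℓ x ≤ ℓ (p j) := by
    have h1 := mul_nonpos_of_nonpos_of_nonneg (hx j).le (sub_nonneg.2 (hj (j - 1)))
    have h2 := mul_nonpos_of_nonpos_of_nonneg (hx (j - 1)).le (sub_nonneg.2 (hj (j + 1)))
    refine sub_nonpos.1 (nonpos_of_mul_nonpos_right ?_ (hp.edgeHeight_prev_pos hN j))
    rw [edgeHeight_mul_map_sub]
    exact add_nonpos h1 h2
  apply hℓ
  have := hi i₀
  have := hi (i₀ + 1)
  have := hj i₀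
  have := hj (i₀ + 1)
  linarith

/-- A linear functional that is nonconstant on edges has exactly one local maximum among the
vertices. -/
lemma existsUnique_localMax [NeZero N] (hN : 3 ≤ N) (hp : IsStrictlyConvex σ p)
    {ℓ : EuclideanSpace ℝ (Fin 2) →ₗ[ℝ] ℝ} (hℓ : ∀ i, ℓ (p (i + 1)) ≠ ℓ (p i)) :
    ∃! i, ℓ (p (i - 1)) < ℓ (p i) ∧ ¬ ℓ (p i) < ℓ (p (i + 1)) := by
  obtain ⟨i, hi⟩ := Finite.exists_max fun i => ℓ (p i)
  refine ⟨i, ⟨lt_of_le_of_ne (hi _) ?_, not_lt.2 (hi _)⟩, ?_⟩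
  · simpa using (hℓ (i - 1)).symm
  rintro j ⟨hj, hj'⟩
  have hj'' : ℓ (p (j + 1)) < ℓ (p j) := lt_of_le_of_ne (not_lt.1 hj') (hℓ j)
  have hcoord := edgeHeight_mul_map_sub (σ := σ) (p := p) ℓ j (p i)
  have h0 := mul_nonneg (hp.edgeHeight_prev_pos hN j).le (sub_nonneg.2 (hi j))
  by_contra hne
  by_cases hij : i = j + 1
  · rw [hij] at hi
    exact (hi j).not_gt hj''
  have h1 := mul_pos (hp j i (Ne.symm hne) hij) (sub_pos.2 hj)
  have h2 := mul_nonneg (hp.edgeHeight_nonneg (j - 1) i) (sub_pos.2 hj'').le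
  linarith

/-- All vertices lie on one side of the line joining `x` to the first vertex of an arc of edges
visible from `x`, and only the preceding vertex can lie on it. -/
lemma planarCross_neg_of_visible (hN : 3 ≤ N) (hp : IsStrictlyConvex σ p)
    {x : EuclideanSpace ℝ (Fin 2)} {i j : ZMod N} (hi : edgeHeight σ p i x < 0)
    (hi' : 0 ≤ edgeHeight σ p (i - 1) x) (hji : j ≠ i) :
    σ * planarCross (p i - x) (p j - x) ≤ 0 ∧
      (j ≠ i - 1 → σ * planarCross (p i - x) (p j - x) < 0) := by
  have hD := hp.edgeHeight_prev_pos hN i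
  have key : edgeHeight σ p i (p (i - 1)) * (σ * planarCross (p i - x) (p j - x)) =
      edgeHeight σ p (i - 1) (p j) * edgeHeight σ p i x -
        edgeHeight σ p i (p j) * edgeHeight σ p (i - 1) x := by
    simp only [edgeHeight_sub_one]
    simp [edgeHeight, planarCross]
    ring
  have h1 := mul_nonneg (hp.edgeHeight_nonneg i j) hi'
  have h2 := mul_nonpos_of_nonneg_of_nonpos (hp.edgeHeight_nonneg (i - 1) j) hi.le
  refine ⟨?_, fun hj => ?_⟩
  · refine nonpos_of_mul_nonpos_right ?_ hD
    rw [key]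
    linarith
  · have h3 := mul_neg_of_pos_of_neg (hp (i - 1) j hj (by simpa using hji)) hi
    refine neg_of_mul_neg_right ?_ hD.le
    rw [key]
    linarith

/-- The edges visible from an exterior point form a single arc. -/
lemma existsUnique_visible_start [NeZero N] (hN : 3 ≤ N) (hp : IsStrictlyConvex σ p)
    {ℓ : EuclideanSpace ℝ (Fin 2) →ₗ[ℝ] ℝ} {i₀ : ZMod N} (hℓ : ℓ (p (i₀ + 1)) ≠ ℓ (p i₀))
    {x : EuclideanSpace ℝ (Fin 2)} (hx : x ∉ convexHull ℝ (Set.range p)) :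
    ∃! i, edgeHeight σ p i x < 0 ∧ ¬ edgeHeight σ p (i - 1) x < 0 := by
  obtain ⟨i₁, hi₁⟩ := hp.exists_edgeHeight_nonneg hN hℓ x
  have hex : ∃ i, edgeHeight σ p i x < 0 ∧ ¬ edgeHeight σ p (i - 1) x < 0 := by
    by_contra! hno
    refine hx (hp.mem_convexHull_of_edgeHeight_nonneg hN (ZMod.forall_of_add_one hi₁ ?_))
    intro i hi
    by_contra! hlt
    have := hno (i + 1) hlt
    rw [add_sub_cancel_right] at this
    exact this.not_ge hi
  obtain ⟨i, hi, hi'⟩ := hex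
  refine ⟨i, ⟨hi, hi'⟩, ?_⟩
  rintro j ⟨hj, hj'⟩
  by_contra hne
  obtain ⟨h1, h1'⟩ := hp.planarCross_neg_of_visible hN hi (not_lt.1 hi') hne
  obtain ⟨h2, h2'⟩ := hp.planarCross_neg_of_visible hN hj (not_lt.1 hj') (Ne.symm hne)
  have hanti : σ * planarCross (p i - x) (p j - x) = -(σ * planarCross (p j - x) (p i - x)) := by
    simp only [planarCross]
    ring
  by_cases hji : j = i - 1
  · have hij : i ≠ j - 1 := fun h => ZMod.two_ne_zero_of_three_le hN (by
      linear_combination h + hji)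
    linarith [h2' hij]
  · linarith [h1' hji]

end IsStrictlyConvex

/-- The edge-supporting lines of a polygon induce a consistent orientation. -/
lemma exists_isStrictlyConvex [NeZero N] (hN : 3 ≤ N)
    (hedge : ∀ i : ZMod N, ∃ u : EuclideanSpace ℝ (Fin 2), ∃ c : ℝ,
      ⟪u, p i⟫ = c ∧ ⟪u, p (i + 1)⟫ = c ∧ ∀ j : ZMod N, j ≠ i → j ≠ i + 1 → ⟪u, p j⟫ < c)
    (hne : ∀ i, p (i + 1) - p i ≠ 0) : ∃ σ : ℝ, IsStrictlyConvex σ p := by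
  choose u c hu hu' hlt using hedge
  set K : ZMod N → ℝ := fun i => -planarCross (p (i + 1) - p i) (u i) with hK
  have hpos : ∀ i j, j ≠ i → j ≠ i + 1 → 0 < edgeHeight (K i) p i (p j) := by
    intro i j hj hj'
    have hd : 0 < ⟪p (i + 1) - p i, p (i + 1) - p i⟫ := real_inner_self_pos.2 (hne i)
    have h0 : ⟪u i, p (i + 1) - p i⟫ = 0 := by rw [inner_sub_right, hu, hu', sub_self]
    have h1 : ⟪u i, p j - p i⟫ < 0 := by
      rw [inner_sub_right, hu]
      linarith [hlt i j hj hj']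
    have hid : edgeHeight (K i) p i (p j) =
        ⟪u i, p (i + 1) - p i⟫ * ⟪p (i + 1) - p i, p j - p i⟫ -
          ⟪u i, p j - p i⟫ * ⟪p (i + 1) - p i, p (i + 1) - p i⟫ := by
      simp only [edgeHeight, hK, planarCross, PiLp.inner_apply, Fin.sum_univ_two, RCLike.inner_apply,
        conj_trivial, PiLp.sub_apply]
      ring
    rw [hid, h0]
    nlinarith [mul_neg_of_neg_of_pos h1 hd]
  have hstep : ∀ i, 0 < K i * K (i + 1) := by
    intro i
    have h1 : 0 < edgeHeight (K i) p i (p (i + 1 + 1)) := hpos i _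
      (fun h => ZMod.two_ne_zero_of_three_le hN (by linear_combination h))
      (fun h => ZMod.one_ne_zero_of_three_le hN (by linear_combination h))
    have h2 : 0 < edgeHeight (K (i + 1)) p (i + 1) (p i) := hpos (i + 1) i
      (fun h => ZMod.one_ne_zero_of_three_le hN (by linear_combination -h))
      (fun h => ZMod.two_ne_zero_of_three_le hN (by linear_combination -h))
    have hcross : planarCross (p (i + 1 + 1) - p (i + 1)) (p i - p (i + 1)) =
        planarCross (p (i + 1) - p i) (p (i + 1 + 1) - p i) := by
      simp [planarCross]
      ring
    rw [edgeHeight] at h1 h2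
    rw [hcross] at h2
    refine pos_of_mul_pos_left (b := planarCross (p (i + 1) - p i) (p (i + 1 + 1) - p i) ^ 2) ?_
      (sq_nonneg _)
    nlinarith [mul_pos h1 h2]
  have hsign : ∀ i, 0 < K 0 * K i := by
    have hK0 : K 0 ≠ 0 := left_ne_zero_of_mul (hstep 0).ne'
    refine ZMod.forall_of_add_one (i₀ := 0) (mul_self_pos.2 hK0) fun i hi => ?_
    refine pos_of_mul_pos_left (b := K i ^ 2) ?_ (sq_nonneg _)
    nlinarith [mul_pos hi (hstep i)]
  refine ⟨K 0, fun i j hj hj' => ?_⟩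
  refine pos_of_mul_pos_left (b := K i ^ 2) ?_ (sq_nonneg _)
  have := mul_pos (hsign i) (hpos i j hj hj')
  simp only [edgeHeight] at this ⊢
  nlinarith

end Polygon


/-- Maydanskiy's cancellation scheme: for a convex polygon in `ℝ²` with vertices
`p 0, …, p (N-1)` listed in cyclic order along the boundary (each an extreme point,
each consecutive pair spanning an edge with all other vertices strictly on one side),
and a generic vector `ξ` (nonzero pairing with every edge direction), the signed
indicator functions of the polarized corner cones sum to the indicator function of
the polygon.  At the vertex `p i`, an edge direction `d ∈ {p (i-1) - p i, p (i+1) - p i}`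
is *flipped* when `⟪ξ, d⟫ > 0`; flipped directions are negated and their coefficient
ranges over `(0, ∞)` instead of `[0, ∞)`, and the cone carries the sign
`(−1)^{number of flipped directions}`. -/
theorem stmt9 (N : ℕ) [NeZero N] (hN : 3 ≤ N)
    (p : ZMod N → EuclideanSpace ℝ (Fin 2))
    (hext : ∀ i : ZMod N,
      p i ∈ Set.extremePoints ℝ (convexHull ℝ (Set.range p)))
    (hedge : ∀ i : ZMod N, ∃ u : EuclideanSpace ℝ (Fin 2), ∃ c : ℝ,
      ⟪u, p i⟫ = c ∧ ⟪u, p (i + 1)⟫ = c ∧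
      ∀ j : ZMod N, j ≠ i → j ≠ i + 1 → ⟪u, p j⟫ < c)
    (ξ : EuclideanSpace ℝ (Fin 2))
    (hξ : ∀ i : ZMod N, ⟪ξ, p (i + 1) - p i⟫ ≠ 0)
    (x : EuclideanSpace ℝ (Fin 2)) :
    ∑ i : ZMod N,
      ((-1 : ℝ) ^ ((if 0 < ⟪ξ, p (i - 1) - p i⟫ then 1 else 0) +
                   (if 0 < ⟪ξ, p (i + 1) - p i⟫ then 1 else 0) : ℕ) *
        Set.indicator
          {y : EuclideanSpace ℝ (Fin 2) | ∃ a b : ℝ,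
            (if 0 < ⟪ξ, p (i - 1) - p i⟫ then 0 < a else 0 ≤ a) ∧
            (if 0 < ⟪ξ, p (i + 1) - p i⟫ then 0 < b else 0 ≤ b) ∧
            y = p i
              + a • (if 0 < ⟪ξ, p (i - 1) - p i⟫ then -(p (i - 1) - p i)
                     else p (i - 1) - p i)
              + b • (if 0 < ⟪ξ, p (i + 1) - p i⟫ then -(p (i + 1) - p i)
                     else p (i + 1) - p i)}
          (fun _ => (1 : ℝ)) x)
    = Set.indicator (convexHull ℝ (Set.range p)) (fun _ => (1 : ℝ)) x := by
  set ℓ : EuclideanSpace ℝ (Fin 2) →ₗ[ℝ] ℝ := (innerSL ℝ ξ).toLinearMap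
  have hinner : ∀ i j, ⟪ξ, p i - p j⟫ = ℓ (p i) - ℓ (p j) := fun i j => inner_sub_right _ _ _
  have hℓ : ∀ i, ℓ (p (i + 1)) ≠ ℓ (p i) := fun i => by
    simpa only [hinner, sub_ne_zero] using hξ i
  obtain ⟨σ, hp⟩ := exists_isStrictlyConvex hN hedge fun i h => hξ i (by simp [h])
  set ε : ZMod N → ℝ := fun i => if ℓ (p i) < ℓ (p (i + 1)) then 1 else 0 with hε
  set B : ZMod N → ℝ := fun i => if edgeHeight σ p i x < 0 then 1 else 0 with hB
  calc
    _ = ∑ i, (ε (i - 1) - B i) * (1 - B (i - 1) - ε i) := by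
      refine Finset.sum_congr rfl fun i _ => ?_
      have hflip : 0 < ⟪ξ, p (i - 1) - p i⟫ ↔ ¬ ℓ (p (i - 1)) < ℓ (p i) := by
        have hne : ℓ (p i) ≠ ℓ (p (i - 1)) := by simpa using hℓ (i - 1)
        rw [hinner, sub_pos, not_lt, le_iff_lt_or_eq, or_iff_left hne]
      have hflip' : 0 < ⟪ξ, p (i + 1) - p i⟫ ↔ ℓ (p i) < ℓ (p (i + 1)) := by
        rw [hinner, sub_pos]
      classical
      rw [Set.indicator_apply]
      simp only [Set.mem_ofPred_eq, mem_polarizedCone_iff (σ := σ) (0 < ⟪ξ, p (i - 1) - p i⟫)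
        (0 < ⟪ξ, p (i + 1) - p i⟫) (hp.edgeHeight_prev_pos hN i)]
      rw [← edgeHeight_sub_one, ← edgeHeight]
      simp only [hflip, hflip', hε, hB, sub_add_cancel]
      by_cases h1 : ℓ (p (i - 1)) < ℓ (p i) <;> by_cases h2 : ℓ (p i) < ℓ (p (i + 1)) <;>
        by_cases h3 : edgeHeight σ p i x < 0 <;>
        by_cases h4 : edgeHeight σ p (i - 1) x < 0 <;> simp [h1, h2, h3, h4]
    _ = ∑ i, (if ℓ (p (i - 1)) < ℓ (p i) ∧ ¬ ℓ (p i) < ℓ (p (i + 1)) then (1 : ℝ) else 0) -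
        ∑ i, (if edgeHeight σ p i x < 0 ∧ ¬ edgeHeight σ p (i - 1) x < 0
          then (1 : ℝ) else 0) := by
      rw [sum_corner_eq]
      congr 1 <;> refine Finset.sum_congr rfl fun i _ => ?_
      · simp only [hε, sub_add_cancel, ite_and]
        split_ifs <;> simp
      · simp only [hB, ite_and]
        split_ifs <;> simp
    _ = _ := by
      rw [sum_ite_eq_one_of_existsUnique (hp.existsUnique_localMax hN hℓ)]
      by_cases hx : x ∈ convexHull ℝ (Set.range p)
      · have hnonneg := hp.edgeHeight_nonneg_of_mem_convexHull hx
        simp [hx, (hnonneg _).not_gt]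
      · rw [sum_ite_eq_one_of_existsUnique (hp.existsUnique_visible_start hN (hℓ 0) hx)]
        simp [hx]
end
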